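/- arXiv:2101.11947 — 2 statements merged into one kernel-verified Lean document; each statement's English description precedes it below -/
import Mathlib

section
/- Let n, k, d be integers with n ≥ 2, n > d ≥ 1, and k ≥ 1. Then f(n,k,d) ≥ f(n−1,k,d) + 1; that is, f(n,k,d) is strictly increasing in n. -/
open scoped Classical

noncomputable section

abbrev F2 : Type := ZMod 2

/-- Number of members of the multiset `H` (counted with multiplicity) containing `x`. -/
def covCount (n : ℕ) (H : Multiset (AffineSubspace F2 (Fin n → F2))) (x : Fin n → F2) : ℕ :=
  Multiset.countP (fun S => x ∈ S) H

/-- `H` is a (k,d)-cover of 𝔽₂ⁿ: a multiset of (n-d)-dimensional affine subspaces covering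
every nonzero point at least `k` times and the origin at most `k-1` times. -/
def IsCover (n k d : ℕ) (H : Multiset (AffineSubspace F2 (Fin n → F2))) : Prop :=
  (∀ S ∈ H, (S : Set (Fin n → F2)).Nonempty ∧ Module.finrank F2 S.direction = n - d) ∧
  (∀ x : Fin n → F2, x ≠ 0 → k ≤ covCount n H x) ∧
  covCount n H 0 < k

/-- `H` is a (k,d;s)-cover of 𝔽₂ⁿ: a (k,d)-cover in which the origin lies in exactly `s`
members (counted with multiplicity). -/
def IsCoverExact (n k d s : ℕ) (H : Multiset (AffineSubspace F2 (Fin n → F2))) : Prop :=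
  (∀ S ∈ H, (S : Set (Fin n → F2)).Nonempty ∧ Module.finrank F2 S.direction = n - d) ∧
  (∀ x : Fin n → F2, x ≠ 0 → k ≤ covCount n H x) ∧
  covCount n H 0 = s

/-- Minimum cardinality of a (k,d)-cover of 𝔽₂ⁿ. -/
def f (n k d : ℕ) : ℕ := sInf {m | ∃ H, IsCover n k d H ∧ Multiset.card H = m}

/-- Minimum cardinality of a (k,d;s)-cover of 𝔽₂ⁿ. -/
def g (n k d s : ℕ) : ℕ := sInf {m | ∃ H, IsCoverExact n k d s H ∧ Multiset.card H = m}

end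


/-- A finite-dimensional subspace contains subspaces of every smaller dimension. -/
lemma aux_exists_sub {N r : ℕ} (D : Submodule F2 (Fin N → F2))
    (h : r ≤ Module.finrank F2 D) :
    ∃ W : Submodule F2 (Fin N → F2), W ≤ D ∧ Module.finrank F2 W = r := by
  let b := Module.finBasis F2 D
  let v : Fin r → (Fin N → F2) := fun i => (b (Fin.castLE h i) : Fin N → F2)
  have hv : LinearIndependent F2 v := by
    have h1 : LinearIndependent F2 (fun i => (b i : Fin N → F2)) :=
      b.linearIndependent.map' D.subtype (Submodule.ker_subtype D)
    exact h1.comp (Fin.castLE h) (Fin.castLE_injective h)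
  refine ⟨Submodule.span F2 (Set.range v), ?_, ?_⟩
  · rw [Submodule.span_le]
    rintro _ ⟨i, rfl⟩
    exact (b (Fin.castLE h i)).2
  · rw [finrank_span_eq_card hv]
    simp

lemma aux_mk_eq {N : ℕ} (W : Submodule F2 (Fin N → F2)) (p x : Fin N → F2)
    (h : x ∈ AffineSubspace.mk' p W) : AffineSubspace.mk' p W = AffineSubspace.mk' x W := by
  have := AffineSubspace.mk'_eq h
  rw [AffineSubspace.direction_mk'] at this
  exact this.symm

/-- Splitting the preimage of one affine subspace. -/
lemma aux_split {N n r : ℕ} (φ : (Fin N → F2) →ₗ[F2] (Fin n → F2))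
    (S : AffineSubspace F2 (Fin n → F2))
    (hr : r ≤ Module.finrank F2 (S.direction.comap φ)) :
    ∃ P : Multiset (AffineSubspace F2 (Fin N → F2)),
      (∀ T ∈ P, (T : Set (Fin N → F2)).Nonempty ∧ Module.finrank F2 T.direction = r) ∧
      ∀ x, covCount N P x = if φ x ∈ S then 1 else 0 := by
  obtain ⟨W, hW, hWr⟩ := aux_exists_sub _ hr
  refine ⟨((Finset.univ.filter (fun p => φ p ∈ S)).image
    (fun p => AffineSubspace.mk' p W)).val, ?_, ?_⟩
  · intro T hT
    rw [Finset.mem_val, Finset.mem_image] at hT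
    obtain ⟨p, -, rfl⟩ := hT
    exact ⟨AffineSubspace.mk'_nonempty p W, by rw [AffineSubspace.direction_mk', hWr]⟩
  · intro x
    have key : ∀ p, φ p ∈ S → x ∈ AffineSubspace.mk' p W → φ x ∈ S := by
      intro p hp hx
      rw [AffineSubspace.mem_mk'] at hx
      have h1 : φ (x -ᵥ p) ∈ S.direction := hW hx
      have h2 := AffineSubspace.vadd_mem_of_mem_direction h1 hp
      rw [vadd_eq_add, ← map_add, vsub_eq_sub, sub_add_cancel] at h2
      exact h2
    unfold covCount
    rw [Multiset.countP_eq_card_filter, ← Finset.filter_val, Finset.card_val]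
    split_ifs with hx
    · rw [Finset.card_eq_one]
      refine ⟨AffineSubspace.mk' x W, ?_⟩
      ext T
      simp only [Finset.mem_filter, Finset.mem_image, Finset.mem_univ, true_and,
        Finset.mem_singleton]
      constructor
      · rintro ⟨⟨p, hp, rfl⟩, h⟩
        exact aux_mk_eq W p x h
      · rintro rfl
        exact ⟨⟨x, hx, rfl⟩, AffineSubspace.self_mem_mk' x W⟩
    · rw [Finset.card_eq_zero, Finset.filter_eq_empty_iff]
      intro T hT h
      rw [Finset.mem_image] at hT
      obtain ⟨p, hp, rfl⟩ := hT
      exact hx (key p (Finset.mem_filter.1 hp).2 h)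

lemma aux_comap_finrank {N n d : ℕ} (hdn : d ≤ n) (φ : (Fin N → F2) →ₗ[F2] (Fin n → F2))
    (D : Submodule F2 (Fin n → F2)) (hD : Module.finrank F2 D = n - d) :
    N - d ≤ Module.finrank F2 (D.comap φ) := by
  have h1 := (D.mkQ.comp φ).finrank_range_add_finrank_ker
  have h2 := D.finrank_quotient_add_finrank
  have h3 := Submodule.finrank_le (LinearMap.range (D.mkQ.comp φ))
  rw [LinearMap.ker_comp, Submodule.ker_mkQ] at h1
  simp only [Module.finrank_fintype_fun_eq_card, Fintype.card_fin] at h1 h2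
  omega

lemma aux_pull {N n d : ℕ} (hdn : d ≤ n) (φ : (Fin N → F2) →ₗ[F2] (Fin n → F2))
    (H : Multiset (AffineSubspace F2 (Fin n → F2)))
    (hH : ∀ S ∈ H, (S : Set (Fin n → F2)).Nonempty ∧ Module.finrank F2 S.direction = n - d) :
    ∃ P : Multiset (AffineSubspace F2 (Fin N → F2)),
      (∀ T ∈ P, (T : Set (Fin N → F2)).Nonempty ∧ Module.finrank F2 T.direction = N - d) ∧
      ∀ x, covCount N P x = covCount n H (φ x) := by
  induction H using Multiset.induction_on with
  | empty => exact ⟨0, by simp, by simp [covCount]⟩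
  | cons S H ih =>
    obtain ⟨P, hP, hP'⟩ := ih (fun T hT => hH T (Multiset.mem_cons_of_mem hT))
    obtain ⟨Q, hQ, hQ'⟩ := aux_split φ S
      (aux_comap_finrank hdn φ _ (hH S (Multiset.mem_cons_self S H)).2)
    refine ⟨P + Q, ?_, ?_⟩
    · intro T hT
      rcases Multiset.mem_add.1 hT with h | h
      · exact hP T h
      · exact hQ T h
    · intro x
      have h1 := hP' x
      have h2 := hQ' x
      unfold covCount at *
      rw [Multiset.countP_add, Multiset.countP_cons, h1, h2]

lemma aux_card_aff {n : ℕ} (S : AffineSubspace F2 (Fin n → F2))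
    (hS : (S : Set (Fin n → F2)).Nonempty) :
    (∑ x : Fin n → F2, if x ∈ S then 1 else 0) = 2 ^ Module.finrank F2 S.direction := by
  obtain ⟨p, hp⟩ := hS
  have h1 : Fintype.card S.direction = 2 ^ Module.finrank F2 S.direction := by
    rw [Module.card_eq_pow_finrank (K := F2), ZMod.card]
  rw [← h1, ← Finset.card_filter, Fintype.card_subtype]
  refine Finset.card_bij' (fun x _ => x - p) (fun x _ => x + p) ?_ ?_ ?_ ?_
  · intro x hx
    simp only [Finset.mem_filter, Finset.mem_univ, true_and] at hx ⊢
    exact AffineSubspace.vsub_mem_direction hx hp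
  · intro x hx
    simp only [Finset.mem_filter, Finset.mem_univ, true_and] at hx ⊢
    exact AffineSubspace.vadd_mem_of_mem_direction hx hp
  · intro x _; simp
  · intro x _; simp

lemma aux_double {n r : ℕ} (H : Multiset (AffineSubspace F2 (Fin n → F2)))
    (hH : ∀ S ∈ H, (S : Set (Fin n → F2)).Nonempty ∧ Module.finrank F2 S.direction = r) :
    ∑ x, covCount n H x = Multiset.card H * 2 ^ r := by
  induction H using Multiset.induction_on with
  | empty => simp [covCount]
  | cons S H ih =>
    have h1 := ih (fun T hT => hH T (Multiset.mem_cons_of_mem hT))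
    obtain ⟨h2, h3⟩ := hH S (Multiset.mem_cons_self S H)
    have h4 := aux_card_aff S h2
    unfold covCount at *
    simp only [Multiset.countP_cons, Finset.sum_add_distrib, Multiset.card_cons]
    rw [h1, h4, h3]
    ring

/-- The functional `x ↦ u · x`. -/
noncomputable def auxDot {n : ℕ} (u : Fin n → F2) : (Fin n → F2) →ₗ[F2] F2 :=
  dotProductBilin F2 F2 u

lemma auxDot_apply {n : ℕ} (u x : Fin n → F2) : auxDot u x = u ⬝ᵥ x := rfl

lemma aux_ker {n : ℕ} (u : Fin (n + 1) → F2) (hu : u ≠ 0) :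
    Module.finrank F2 (LinearMap.ker (auxDot u)) = n := by
  have h1 := (auxDot u).finrank_range_add_finrank_ker
  have h2 : LinearMap.range (auxDot u) = ⊤ := by
    apply LinearMap.range_eq_top.2
    apply LinearMap.surjective
    intro h
    apply hu
    funext i
    have := LinearMap.congr_fun h (Pi.single i 1)
    simpa [auxDot_apply] using this
  rw [h2, finrank_top] at h1
  simp only [Module.finrank_fintype_fun_eq_card, Fintype.card_fin, Module.finrank_self] at h1
  omega

lemma aux_card_ker {n : ℕ} (x : Fin (n + 1) → F2) (hx : x ≠ 0) :
    (∑ u : Fin (n + 1) → F2, if u ⬝ᵥ x = 0 then 1 else 0) = 2 ^ n := by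
  have h1 : Fintype.card (LinearMap.ker (auxDot x)) = 2 ^ n := by
    rw [Module.card_eq_pow_finrank (K := F2), ZMod.card, aux_ker x hx]
  rw [← h1, ← Finset.card_filter, Fintype.card_subtype]
  congr 1
  ext u
  simp [LinearMap.mem_ker, auxDot_apply, dotProduct_comm]

/-- Averaging: some hyperplane carries less than half of the weight. -/
lemma aux_avg {n k : ℕ} (c : (Fin (n + 1) → F2) → ℕ) (h0 : c 0 < k)
    (hc : ∀ x, x ≠ 0 → k ≤ c x) :
    ∃ u : Fin (n + 1) → F2, u ≠ 0 ∧
      2 * (∑ x, if u ⬝ᵥ x = 0 then c x else 0) < ∑ x, c x := by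
  by_contra! hcon
  set C := ∑ x, c x with hC
  have hcard : (Finset.univ.erase (0 : Fin (n + 1) → F2)).card = 2 ^ (n + 1) - 1 := by
    rw [Finset.card_erase_of_mem (Finset.mem_univ _)]
    simp [ZMod.card]
  have hCs : c 0 + ∑ x ∈ Finset.univ.erase (0 : Fin (n + 1) → F2), c x = C :=
    Finset.add_sum_erase _ _ (Finset.mem_univ _)
  have hClow : (2 ^ (n + 1) - 1) * k ≤ ∑ x ∈ Finset.univ.erase (0 : Fin (n + 1) → F2), c x := by
    rw [← hcard, ← smul_eq_mul]
    exact Finset.card_nsmul_le_sum _ _ _ (fun x hx => hc x (Finset.ne_of_mem_erase hx))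
  have hF : C + ∑ u ∈ Finset.univ.erase (0 : Fin (n + 1) → F2),
      (∑ x, if u ⬝ᵥ x = 0 then c x else 0) =
      ∑ u : Fin (n + 1) → F2, ∑ x, if u ⬝ᵥ x = 0 then c x else 0 := by
    rw [← Finset.add_sum_erase _ _ (Finset.mem_univ (0 : Fin (n + 1) → F2))]
    simp [hC]
  have hG : (∑ u : Fin (n + 1) → F2, ∑ x, if u ⬝ᵥ x = 0 then c x else 0) =
      c 0 * 2 ^ (n + 1) + (∑ x ∈ Finset.univ.erase (0 : Fin (n + 1) → F2), c x) * 2 ^ n := by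
    rw [Finset.sum_comm, ← Finset.add_sum_erase _ _ (Finset.mem_univ (0 : Fin (n + 1) → F2)),
      Finset.sum_mul]
    congr 1
    · simp [ZMod.card, mul_comm]
    · refine Finset.sum_congr rfl (fun x hx => ?_)
      rw [← aux_card_ker x (Finset.ne_of_mem_erase hx), Finset.mul_sum]
      simp
  have hlow : (2 ^ (n + 1) - 1) * C ≤ ∑ u ∈ Finset.univ.erase (0 : Fin (n + 1) → F2),
      2 * (∑ x, if u ⬝ᵥ x = 0 then c x else 0) := by
    rw [← hcard, ← smul_eq_mul]
    exact Finset.card_nsmul_le_sum _ _ _ (fun u hu => hcon u (Finset.ne_of_mem_erase hu))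
  rw [← Finset.mul_sum] at hlow
  have hpow : 1 < 2 ^ (n + 1) := Nat.one_lt_two_pow (by omega)
  generalize (∑ u ∈ Finset.univ.erase (0 : Fin (n + 1) → F2),
      (∑ x, if u ⬝ᵥ x = 0 then c x else 0)) = A at *
  generalize (∑ x ∈ Finset.univ.erase (0 : Fin (n + 1) → F2), c x) = B at *
  rw [hG] at hF
  rw [pow_succ] at *
  obtain ⟨q, hq⟩ : ∃ q, 2 ^ n * 2 = q + 1 := ⟨2 ^ n * 2 - 1, by omega⟩
  have hq2 : 2 ^ n * 2 - 1 = q := by omega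
  rw [hq2] at hlow hClow
  have hqpos : 0 < q := by omega
  have e1 : 2 * (B * 2 ^ n) = B * (q + 1) := by rw [← hq]; ring
  rw [hq] at hF
  have e2 : q * c 0 < q * k := Nat.mul_lt_mul_of_pos_left h0 hqpos
  nlinarith

/-- Covers exist. -/
lemma aux_exists_cover (n k d : ℕ) (hd : 1 ≤ d) (hk : 1 ≤ k) :
    ∃ H, IsCover (n + 1) k d H := by
  have hW : ∀ x : Fin (n + 1) → F2, ∃ W : Submodule F2 (Fin (n + 1) → F2),
      Module.finrank F2 W = n + 1 - d ∧ (x ≠ 0 → x ∉ W) := by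
    intro x
    by_cases hx : x = 0
    · obtain ⟨W, -, h⟩ := aux_exists_sub (N := n + 1) (r := n + 1 - d) ⊤
        (by rw [finrank_top]; simp)
      exact ⟨W, h, fun h => absurd hx h⟩
    · obtain ⟨i, hi⟩ := Function.ne_iff.1 hx
      have hu : (Pi.single i 1 : Fin (n + 1) → F2) ≠ 0 := by
        intro h
        have := congrFun h i
        simp at this
      obtain ⟨W, h1, h2⟩ := aux_exists_sub (r := n + 1 - d)
        (LinearMap.ker (auxDot (Pi.single i 1 : Fin (n + 1) → F2)))
        (by rw [aux_ker _ hu]; omega)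
      refine ⟨W, h2, fun _ hxW => hi ?_⟩
      have := h1 hxW
      simpa [LinearMap.mem_ker, auxDot_apply] using this
  choose W hW1 hW2 using hW
  let M : (Fin (n + 1) → F2) → Multiset (AffineSubspace F2 (Fin (n + 1) → F2)) :=
    fun x => Multiset.replicate k (AffineSubspace.mk' x (W x))
  have hcov : ∀ y, covCount (n + 1) (∑ x ∈ Finset.univ.erase 0, M x) y =
      ∑ x ∈ Finset.univ.erase 0, covCount (n + 1) (M x) y := by
    intro y
    exact map_sum (Multiset.countPAddMonoidHom (fun S => y ∈ S)) _ _
  refine ⟨∑ x ∈ Finset.univ.erase 0, M x, ?_, ?_, ?_⟩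
  · intro S hS
    rw [Multiset.mem_sum] at hS
    obtain ⟨x, -, hx⟩ := hS
    rw [Multiset.eq_of_mem_replicate hx]
    exact ⟨AffineSubspace.mk'_nonempty _ _, by rw [AffineSubspace.direction_mk', hW1]⟩
  · intro y hy
    rw [hcov]
    refine le_trans ?_ (Finset.single_le_sum (fun _ _ => Nat.zero_le _)
      (Finset.mem_erase.2 ⟨hy, Finset.mem_univ y⟩))
    apply le_of_eq
    have : Multiset.countP (fun S => y ∈ S) (M y) = Multiset.card (M y) := by
      rw [Multiset.countP_eq_card]
      intro S hS
      rw [Multiset.eq_of_mem_replicate hS]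
      exact AffineSubspace.self_mem_mk' _ _
    unfold covCount
    rw [this, Multiset.card_replicate]
  · rw [hcov, Finset.sum_eq_zero]
    · exact hk
    · intro x hx
      unfold covCount
      rw [Multiset.countP_eq_zero]
      intro S hS h
      rw [Multiset.eq_of_mem_replicate hS, AffineSubspace.mem_mk'] at h
      apply hW2 x (Finset.ne_of_mem_erase hx)
      simpa using h

theorem stmt8 (n k d : ℕ) (hn : 2 ≤ n) (hd : 1 ≤ d) (hdn : d < n) (hk : 1 ≤ k) :
    f (n - 1) k d + 1 ≤ f n k d := by
  obtain ⟨N, rfl⟩ : ∃ N, n = N + 1 := ⟨n - 1, by omega⟩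
  rw [Nat.add_sub_cancel]
  have hne : {m | ∃ H, IsCover (N + 1) k d H ∧ Multiset.card H = m}.Nonempty := by
    obtain ⟨H, hH⟩ := aux_exists_cover N k d hd hk
    exact ⟨_, H, hH, rfl⟩
  obtain ⟨H, ⟨hH1, hH2, hH3⟩, hHm⟩ := Nat.sInf_mem hne
  change Multiset.card H = f (N + 1) k d at hHm
  rw [← hHm]
  obtain ⟨u, hu, hlt⟩ := aux_avg (covCount (N + 1) H) hH3 hH2
  let e : (Fin N → F2) ≃ₗ[F2] LinearMap.ker (auxDot u) :=
    LinearEquiv.ofFinrankEq _ _ (by rw [aux_ker u hu]; simp)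
  let φ : (Fin N → F2) →ₗ[F2] (Fin (N + 1) → F2) :=
    (LinearMap.ker (auxDot u)).subtype.comp e.toLinearMap
  have hφ : ∀ x, φ x = (e x : Fin (N + 1) → F2) := fun _ => rfl
  obtain ⟨P, hP1, hP2⟩ := aux_pull hdn.le φ H hH1
  have hPcov : IsCover N k d P := by
    refine ⟨hP1, ?_, ?_⟩
    · intro x hx
      rw [hP2]
      apply hH2
      rw [hφ]
      simpa using hx
    · rw [hP2, map_zero]
      exact hH3
  have hle : f N k d ≤ Multiset.card P := Nat.sInf_le ⟨P, hPcov, rfl⟩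
  have hsumP := aux_double P hP1
  have hsumH := aux_double H hH1
  have hsum : ∑ x, covCount N P x =
      ∑ x, if u ⬝ᵥ x = 0 then covCount (N + 1) H x else 0 := by
    rw [← Finset.sum_filter]
    refine Finset.sum_bij (fun x _ => φ x) ?_ ?_ ?_ ?_
    · intro x _
      simp only [Finset.mem_filter, Finset.mem_univ, true_and]
      exact (e x).2
    · intro x _ y _ h
      exact e.injective (Subtype.ext h)
    · intro y hy
      simp only [Finset.mem_filter, Finset.mem_univ, true_and] at hy
      refine ⟨e.symm ⟨y, hy⟩, Finset.mem_univ _, ?_⟩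
      rw [hφ, LinearEquiv.apply_symm_apply]
    · intro x _
      exact hP2 x
  rw [← hsum, hsumP, hsumH, show N + 1 - d = (N - d) + 1 by omega, pow_succ] at hlt
  have hfin : Multiset.card P < Multiset.card H := by
    by_contra! hge
    have := Nat.mul_le_mul_right (2 ^ (N - d)) hge
    nlinarith
  omega
end

section
/- Let n, k, d be positive integers with n ≥ d ≥ 1. Then g(n,k,d;k−1) = n + 2^d·k − d − 1. -/
open scoped Classical

open Polynomial

/-- minimal number of powers of two, each at most `2 ^ D`, summing to `e` -/
def pw : ℕ → ℕ → ℕ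
  | 0, e => e
  | D + 1, e => e % 2 + pw D (e / 2)

lemma pw_add_pow (D : ℕ) : ∀ (j e : ℕ), j ≤ D → pw D (e + 2 ^ j) ≤ pw D e + 1 := by
  induction D with
  | zero => intro j e hj; obtain rfl : j = 0 := by omega
            simp [pw]
  | succ D ih =>
    intro j e hj
    rcases j with _ | j
    · simp only [pw, pow_zero]
      rcases Nat.mod_two_eq_zero_or_one e with h | h
      · have h1 : (e + 1) / 2 = e / 2 := by omega
        have h2 : (e + 1) % 2 = 1 := by omega
        rw [h1, h2, h]; omega
      · have h1 : (e + 1) / 2 = e / 2 + 2 ^ 0 := by rw [pow_zero]; omega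
        have h2 : (e + 1) % 2 = 0 := by omega
        have := ih 0 (e / 2) (Nat.zero_le _)
        rw [h1, h2, h]; omega
    · simp only [pw]
      have h1 : (e + 2 ^ (j + 1)) / 2 = e / 2 + 2 ^ j := by rw [pow_succ]; omega
      have h2 : (e + 2 ^ (j + 1)) % 2 = e % 2 := by rw [pow_succ]; omega
      have := ih j (e / 2) (by omega)
      rw [h1, h2]; omega

lemma pw_add_big (D d : ℕ) : ∀ e : ℕ, pw D (e + 2 ^ (D + d)) = pw D e + 2 ^ d := by
  induction D with
  | zero => intro e; simp [pw]
  | succ D ih =>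
    intro e
    have h0 : 2 ^ (D + 1 + d) = 2 * 2 ^ (D + d) := by rw [← pow_succ']; congr 1; omega
    have h1 : (e + 2 ^ (D + 1 + d)) / 2 = e / 2 + 2 ^ (D + d) := by omega
    have h2 : (e + 2 ^ (D + 1 + d)) % 2 = e % 2 := by omega
    simp only [pw]
    rw [h1, h2, ih]; omega

lemma pw_zero (D : ℕ) : pw D 0 = 0 := by
  induction D with
  | zero => rfl
  | succ D ih => simp [pw, ih]

lemma pw_last (D d : ℕ) : pw D (2 ^ (D + d) - 1) + 1 = D + 2 ^ d := by
  induction D with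
  | zero => have := Nat.one_le_two_pow (n := d); simp only [pw, Nat.zero_add]; omega
  | succ D ih =>
    have h0 : 2 ^ (D + 1 + d) = 2 * 2 ^ (D + d) := by rw [← pow_succ']; congr 1; omega
    have := Nat.one_le_two_pow (n := D + d)
    have h1 : (2 ^ (D + 1 + d) - 1) / 2 = 2 ^ (D + d) - 1 := by omega
    have h2 : (2 ^ (D + 1 + d) - 1) % 2 = 1 := by omega
    simp only [pw]
    rw [h1, h2]; omega

section poly
variable {K : Type*} [Field K]

noncomputable def VV (K : Type*) [Field K] (D : ℕ) (m : ℤ) : Submodule K K[X] :=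
  Submodule.span K {P | ∃ e, (pw D e : ℤ) ≤ m ∧ P = X ^ e}

noncomputable def LL (K : Type*) [Field K] (D : ℕ) : Submodule K K[X] :=
  Submodule.span K {P | ∃ j, j ≤ D ∧ P = X ^ (2 ^ j)}

lemma X_mem_VV {D : ℕ} {m : ℤ} {e : ℕ} (h : (pw D e : ℤ) ≤ m) : (X ^ e : K[X]) ∈ VV K D m :=
  Submodule.subset_span ⟨e, h, rfl⟩

lemma VV_mono {D : ℕ} {m m' : ℤ} (h : m ≤ m') : VV K D m ≤ VV K D m' := by
  apply Submodule.span_mono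
  rintro _ ⟨e, he, rfl⟩
  exact ⟨e, he.trans h, rfl⟩

lemma LL_mul {D : ℕ} {m : ℤ} {P L : K[X]} (hL : L ∈ LL K D) (hP : P ∈ VV K D m) :
    L * P ∈ VV K D (m + 1) := by
  have h : L * P ∈ LL K D * VV K D m := Submodule.mul_mem_mul hL hP
  unfold LL VV at h
  rw [Submodule.span_mul_span] at h
  refine (Submodule.span_le.2 ?_) h
  rintro _ ⟨_, ⟨j, hj, rfl⟩, _, ⟨e, he, rfl⟩, rfl⟩
  have := pw_add_pow D j e hj
  simp only [← pow_add]
  apply X_mem_VV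
  rw [add_comm]; omega

lemma aff_mul {D : ℕ} {m : ℤ} {P L : K[X]} {c : K} (hL : L ∈ LL K D) (hP : P ∈ VV K D m) :
    (L - C c) * P ∈ VV K D (m + 1) := by
  rw [sub_mul, ← smul_eq_C_mul]
  exact Submodule.sub_mem _ (LL_mul hL hP) (Submodule.smul_mem _ _ (VV_mono (by omega) hP))

lemma VV_coeff {D : ℕ} {m : ℤ} {P : K[X]} (hP : P ∈ VV K D m) (e : ℕ) (he : P.coeff e ≠ 0) :
    (pw D e : ℤ) ≤ m := by
  by_contra hlt
  apply he
  induction hP using Submodule.span_induction with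
  | mem x h =>
    obtain ⟨e', h', rfl⟩ := h
    rw [coeff_X_pow, if_neg]
    rintro rfl; exact hlt h'
  | zero => simp
  | add x y _ _ hx hy =>
    rw [coeff_add]
    by_cases h1 : x.coeff e = 0
    · by_cases h2 : y.coeff e = 0
      · simp [h1, h2]
      · exact absurd (hy h2) h2
    · exact absurd (hx h1) h1
  | smul a x _ hx =>
    rw [coeff_smul]
    by_cases h1 : x.coeff e = 0
    · simp [h1]
    · exact absurd (hx h1) h1

lemma VV_div {D d : ℕ} (hsmall : D + d ≠ 0) {m : ℤ} {P : K[X]} (hP : P ∈ VV K D m) :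
    ∃ R ∈ VV K D (m - 2 ^ d), ∃ r ∈ VV K D m, r ∈ degreeLT K (2 ^ (D + d)) ∧
      P = (X ^ (2 ^ (D + d)) - X) * R + r := by
  induction hP using Submodule.span_induction with
  | mem x h =>
    obtain ⟨e, h', rfl⟩ := h
    induction e using Nat.strong_induction_on with
    | _ e ih =>
      by_cases hlt : e < 2 ^ (D + d)
      · refine ⟨0, zero_mem _, X ^ e, X_mem_VV h', ?_, by simp⟩
        rw [mem_degreeLT, degree_X_pow]; exact_mod_cast hlt
      · obtain ⟨e', rfl⟩ := Nat.exists_eq_add_of_le' (not_lt.1 hlt)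
        have hb := pw_add_big D d e'
        have h1 := pw_add_pow D 0 e' (Nat.zero_le _)
        have h3 : 1 ≤ 2 ^ d := Nat.one_le_two_pow
        have h4 : 2 ≤ 2 ^ (D + d) := by
          calc 2 = 2 ^ 1 := rfl
            _ ≤ _ := Nat.pow_le_pow_right (by norm_num) (by omega)
        rw [pow_zero] at h1
        rw [hb] at h'
        push_cast at h'
        obtain ⟨R, hR, r, hr, hr2, hE⟩ := ih (e' + 1) (by omega) (by
          have : (pw D (e' + 1) : ℤ) ≤ pw D e' + 1 := by exact_mod_cast h1
          have : (1 : ℤ) ≤ 2 ^ d := by exact_mod_cast h3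
          linarith)
        refine ⟨R + X ^ e', Submodule.add_mem _ hR (X_mem_VV (by linarith)), r, hr, hr2, ?_⟩
        rw [mul_add, add_right_comm, ← hE]; ring
  | zero => exact ⟨0, zero_mem _, 0, zero_mem _, zero_mem _, by simp⟩
  | add x y _ _ hx hy =>
    obtain ⟨R, hR, r, hr, hr2, rfl⟩ := hx
    obtain ⟨R', hR', r', hr', hr2', rfl⟩ := hy
    exact ⟨R + R', add_mem hR hR', r + r', add_mem hr hr', add_mem hr2 hr2', by ring⟩
  | smul a x _ hx =>
    obtain ⟨R, hR, r, hr, hr2, rfl⟩ := hx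
    exact ⟨a • R, Submodule.smul_mem _ _ hR, a • r, Submodule.smul_mem _ _ hr,
      Submodule.smul_mem _ _ hr2, by simp only [smul_eq_C_mul]; ring⟩

lemma LL_additive [CharP K 2] {D : ℕ} {L : K[X]} (hL : L ∈ LL K D) (a : K) :
    L.comp (X - C a) = L - C (L.eval a) := by
  induction hL using Submodule.span_induction with
  | mem x h =>
    obtain ⟨j, _, rfl⟩ := h
    simp [sub_pow_char_pow]
  | zero => simp
  | add x y _ _ hx hy => rw [add_comp, hx, hy, eval_add, C_add]; ring
  | smul c x _ hx => rw [smul_comp, hx, eval_smul, smul_sub, smul_C]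

lemma LL_sq [CharP K 2] {D : ℕ} {L : K[X]} (hL : L ∈ LL K D) : L ^ 2 ∈ LL K (D + 1) := by
  induction hL using Submodule.span_induction with
  | mem x h =>
    obtain ⟨j, hj, rfl⟩ := h
    exact Submodule.subset_span ⟨j + 1, by omega, by rw [← pow_mul, pow_succ]⟩
  | zero => simp
  | add x y _ _ hx hy => rw [add_pow_char]; exact add_mem hx hy
  | smul c x _ hx => rw [_root_.smul_pow]; exact Submodule.smul_mem _ _ hx

lemma LL_mono {D : ℕ} : LL K D ≤ LL K (D + 1) := by
  apply Submodule.span_mono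
  rintro _ ⟨j, hj, rfl⟩
  exact ⟨j, by omega, rfl⟩

variable {E : Type*} [AddCommGroup E] [Module F2 E] [Fintype E] [Module F2 K]

lemma exists_hyper {D : ℕ} (U : Submodule F2 E) (hU : Module.finrank F2 U = D + 1) :
    ∃ U' : Submodule F2 E, ∃ v : E, Module.finrank F2 U' = D ∧ v ∉ U' ∧
      ∀ x, x ∈ U ↔ (x ∈ U' ∨ x - v ∈ U') := by
  let b := Module.finBasisOfFinrankEq F2 U hU
  let φ := b.coord (Fin.last D)
  have hφ : φ (b (Fin.last D)) = 1 := by simp [φ]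
  have hsurj : Function.Surjective φ := fun c => ⟨c • b (Fin.last D), by simp [hφ]⟩
  have hm : ∀ y : U, (y : E) ∈ (LinearMap.ker φ).map U.subtype ↔ φ y = 0 := by
    intro y
    simp
  refine ⟨(LinearMap.ker φ).map U.subtype, b (Fin.last D), ?_, ?_, ?_⟩
  · rw [Submodule.finrank_map_subtype_eq]
    have := LinearMap.finrank_range_add_finrank_ker φ
    rw [LinearMap.range_eq_top.2 hsurj, finrank_top, Module.finrank_self, hU] at this
    omega
  · rw [hm, hφ]; exact one_ne_zero
  · intro x
    constructor
    · intro hx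
      have h01 : ∀ c : F2, c = 0 ∨ c = 1 := by decide
      rcases h01 (φ ⟨x, hx⟩) with h | h
      · left; exact (hm ⟨x, hx⟩).2 h
      · right
        refine (hm (⟨x, hx⟩ - b (Fin.last D))).2 ?_
        rw [map_sub, h, hφ, sub_self]
    · have hle : (LinearMap.ker φ).map U.subtype ≤ U := Submodule.map_subtype_le _ _
      rintro (h | h)
      · exact hle h
      · have := U.add_mem (hle h) (b (Fin.last D)).2
        simpa using this

lemma subspace_poly [CharP K 2] (ι : E →ₗ[F2] K) :
    ∀ (D : ℕ) (U : Submodule F2 E), Module.finrank F2 U = D →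
      ∏ x ∈ Finset.univ.filter (fun x => x ∈ U), (X - C (ι x)) ∈ LL K D := by
  intro D
  induction D with
  | zero =>
    intro U hU
    have : U = ⊥ := Submodule.finrank_eq_zero.1 hU
    subst this
    have : (Finset.univ.filter (fun x : E => x ∈ (⊥ : Submodule F2 E))) = {0} := by
      ext x; simp
    rw [this]
    simp only [Finset.prod_singleton, map_zero, sub_zero]
    exact Submodule.subset_span ⟨0, le_rfl, by simp⟩
  | succ D ih =>
    intro U hU
    obtain ⟨U', v, hU', hv, hx⟩ := exists_hyper U hU
    have hL := ih U' hU'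
    set L := ∏ x ∈ Finset.univ.filter (fun x => x ∈ U'), (X - C (ι x)) with hLdef
    have hset : Finset.univ.filter (fun x => x ∈ U) = Finset.univ.filter (fun x => x ∈ U') ∪
        (Finset.univ.filter (fun x => x ∈ U')).image (fun x => x + v) := by
      ext x
      simp only [Finset.mem_filter, Finset.mem_univ, true_and, Finset.mem_union, Finset.mem_image,
        hx x]
      constructor
      · rintro (h | h)
        · exact Or.inl h
        · exact Or.inr ⟨_, h, by simp⟩
      · rintro (h | ⟨y, h, rfl⟩)
        · exact Or.inl h
        · right; simpa using h
    have hdisj : Disjoint (Finset.univ.filter (fun x => x ∈ U'))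
        ((Finset.univ.filter (fun x => x ∈ U')).image (fun x => x + v)) := by
      rw [Finset.disjoint_left]
      intro x h1 h2
      simp only [Finset.mem_filter, Finset.mem_univ, true_and, Finset.mem_image] at h1 h2
      obtain ⟨y, hy, rfl⟩ := h2
      exact hv ((U'.add_mem_iff_right hy).1 h1)
    rw [hset, Finset.prod_union hdisj, Finset.prod_image (fun a _ b _ h => add_right_cancel h)]
    have h2 : ∏ x ∈ Finset.univ.filter (fun x => x ∈ U'), (X - C (ι (x + v)))
        = L.comp (X - C (ι v)) := by
      rw [hLdef, prod_comp]
      refine Finset.prod_congr rfl fun x _ => ?_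
      simp; ring
    rw [h2, LL_additive hL, ← hLdef, mul_sub, mul_comm L (C _), ← smul_eq_C_mul, ← pow_two]
    exact sub_mem (LL_sq hL) (Submodule.smul_mem _ _ (LL_mono hL))

lemma affine_poly [CharP K 2] (ι : E →ₗ[F2] K) (D : ℕ) (S : AffineSubspace F2 E)
    (hS : (S : Set E).Nonempty) (hD : Module.finrank F2 S.direction = D) :
    ∃ L ∈ LL K D, ∃ c, ∏ x ∈ Finset.univ.filter (fun x => x ∈ S), (X - C (ι x)) = L - C c := by
  obtain ⟨p, hp⟩ := hS
  have hL := subspace_poly ι D S.direction hD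
  refine ⟨_, hL, eval (ι p) (∏ x ∈ Finset.univ.filter (fun x => x ∈ S.direction), (X - C (ι x))), ?_⟩
  · rw [← LL_additive hL (ι p), prod_comp]
    symm
    refine Finset.prod_bij (fun x _ => x + p) ?_ ?_ ?_ ?_
    · intro a ha
      simp only [Finset.mem_filter, Finset.mem_univ, true_and] at ha ⊢
      exact AffineSubspace.vadd_mem_of_mem_direction ha hp
    · intro a _ b _ h; exact add_right_cancel h
    · intro b hb
      simp only [Finset.mem_filter, Finset.mem_univ, true_and] at hb ⊢
      exact ⟨b - p, AffineSubspace.vsub_mem_direction hb hp, by simp⟩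
    · intro a _
      simp; ring

lemma multiset_poly [CharP K 2] (ι : E →ₗ[F2] K) (D : ℕ) (H : Multiset (AffineSubspace F2 E))
    (hH : ∀ S ∈ H, (S : Set E).Nonempty ∧ Module.finrank F2 S.direction = D) :
    ∏ x : E, (X - C (ι x)) ^ (Multiset.countP (fun S => x ∈ S) H) ∈ VV K D (Multiset.card H) := by
  induction H using Multiset.induction_on with
  | empty =>
    simp only [Multiset.countP_zero, pow_zero, Finset.prod_const_one, Multiset.card_zero]
    have h0 := pw_zero D
    have := X_mem_VV (K := K) (D := D) (m := 0) (e := 0) (by simp [h0])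
    simpa using this
  | cons S H ih =>
    have ih := ih (fun T hT => hH T (Multiset.mem_cons_of_mem hT))
    obtain ⟨hne, hf⟩ := hH S (Multiset.mem_cons_self _ _)
    obtain ⟨L, hL, c, hE⟩ := affine_poly ι D S hne hf
    have := aff_mul (c := c) hL ih
    rw [← hE, Finset.prod_filter, ← Finset.prod_mul_distrib] at this
    rw [Multiset.card_cons]
    push_cast
    convert this using 2 with x
    rw [Multiset.countP_cons]
    split_ifs
    · rw [pow_succ]; ring
    · simp

end poly

lemma lower (n k d : ℕ) (hn : 1 ≤ n) (hk : 1 ≤ k) (hdn : d ≤ n)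
    (H : Multiset (AffineSubspace F2 (Fin n → F2))) (hH : IsCoverExact n k d (k - 1) H) :
    n + 2 ^ d * k - d - 1 ≤ Multiset.card H := by
  obtain ⟨b, rfl⟩ : ∃ b, k = b + 1 := ⟨k - 1, by omega⟩
  obtain ⟨D, rfl⟩ : ∃ D, n = D + d := ⟨n - d, by omega⟩
  obtain ⟨h1, h2, h3⟩ := hH
  simp only [Nat.add_sub_cancel] at h1 h3
  let K := GaloisField 2 (D + d)
  letI : Fintype K := Fintype.ofFinite K
  have hcard : Fintype.card K = 2 ^ (D + d) := by
    rw [Fintype.card_eq_nat_card]; exact GaloisField.card 2 _ (by omega)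
  have hfr : Module.finrank F2 (Fin (D + d) → F2) = Module.finrank F2 K := by
    rw [GaloisField.finrank 2 (by omega)]; simp
  let ι : (Fin (D + d) → F2) ≃ₗ[F2] K := LinearEquiv.ofFinrankEq _ _ hfr
  have hF := multiset_poly ι.toLinearMap D H h1
  set N := Multiset.card H
  have hQ : ∏ x : Fin (D + d) → F2, (X - C (ι x)) = X ^ (2 ^ (D + d)) - X := by
    have h1 : ∏ x : Fin (D + d) → F2, (X - C (ι x)) = ∏ y : K, (X - C y) :=
      Equiv.prod_comp ι.toEquiv (fun y : K => X - C y)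
    rw [h1, ← hcard]
    have hm : (X ^ Fintype.card K - X : K[X]).Monic :=
      monic_X_pow_sub (by rw [degree_X]; exact_mod_cast Fintype.one_lt_card)
    have := prod_multiset_X_sub_C_of_monic_of_roots_card_eq hm (by
      rw [FiniteField.roots_X_pow_card_sub_X,
        FiniteField.X_pow_card_sub_X_natDegree_eq K Fintype.one_lt_card]
      rfl)
    rw [FiniteField.roots_X_pow_card_sub_X] at this
    exact this
  have hcx : ∀ x, b ≤ covCount (D + d) H x := by
    intro x
    by_cases hx : x = 0
    · rw [hx, h3]
    · have := h2 x hx; omega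
  set G : K[X] := ∏ x, (X - C (ι x)) ^ (covCount (D + d) H x - b) with hG
  have hFG : (X ^ (2 ^ (D + d)) - X) ^ b * G ∈ VV K D N := by
    convert hF using 1
    rw [← hQ, ← Finset.prod_pow, hG, ← Finset.prod_mul_distrib]
    refine Finset.prod_congr rfl fun x _ => ?_
    rw [← pow_add, Nat.add_sub_cancel' (hcx x)]
    rfl
  have hdeg : (X ^ (2 ^ (D + d)) - X : K[X]).degree = (2 ^ (D + d) : ℕ) := by
    rw [degree_eq_natDegree (FiniteField.X_pow_card_sub_X_ne_zero K (Nat.one_lt_two_pow (by omega))),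
      FiniteField.X_pow_card_sub_X_natDegree_eq K (Nat.one_lt_two_pow (by omega))]
  have key : ∀ (c : ℕ) (m : ℤ), (X ^ (2 ^ (D + d)) - X) ^ c * G ∈ VV K D m →
      G ∈ VV K D (m - c * 2 ^ d) := by
    intro c
    induction c with
    | zero => intro m h; simpa using h
    | succ c ih =>
      intro m h
      obtain ⟨R, hR, r, hr, hr2, hE⟩ := VV_div (d := d) (by omega) h
      rw [mem_degreeLT, ← hdeg] at hr2
      have hdvd : (X ^ (2 ^ (D + d)) - X : K[X]) ∣ r :=
        ⟨(X ^ (2 ^ (D + d)) - X) ^ c * G - R, by rw [mul_sub, ← mul_assoc, ← pow_succ', hE]; ring⟩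
      have hr0 : r = 0 := eq_zero_of_dvd_of_degree_lt hdvd hr2
      have hne := FiniteField.X_pow_card_sub_X_ne_zero K (p := 2 ^ (D + d))
        (Nat.one_lt_two_pow (by omega))
      have hRe : (X ^ (2 ^ (D + d)) - X) ^ c * G = R := by
        apply mul_left_cancel₀ hne
        rw [← mul_assoc, ← pow_succ', hE, hr0, add_zero]
      rw [← hRe] at hR
      have := ih _ hR
      convert this using 1
      push_cast; ring
  have hGV := key b N hFG
  obtain ⟨R, hR, r, hr, hr2, hE⟩ := VV_div (d := d) (by omega) hGV
  rw [mem_degreeLT] at hr2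
  have hev : ∀ y : K, r.eval y = G.eval y := by
    intro y
    have hy : y ^ 2 ^ (D + d) = y := by rw [← hcard]; exact FiniteField.pow_card y
    rw [hE]; simp [hy]
  have hG0 : G.eval 0 ≠ 0 := by
    rw [hG, eval_prod, Finset.prod_ne_zero_iff]
    intro x _
    by_cases hx : x = 0
    · rw [hx, h3]; simp
    · simp [hx]
  have hG1 : ∀ y : K, y ≠ 0 → G.eval y = 0 := by
    intro y hy
    rw [hG, eval_prod]
    apply Finset.prod_eq_zero (Finset.mem_univ (ι.symm y))
    have : covCount (D + d) H (ι.symm y) - b ≠ 0 := by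
      have := h2 (ι.symm y) (by simpa using hy)
      omega
    simp [this]
  have hc : r.coeff (2 ^ (D + d) - 1) ≠ 0 := by
    intro h0
    have hpos := Nat.one_le_two_pow (n := D + d)
    have hr0 : r = 0 := by
      apply eq_zero_of_degree_lt_of_eval_finset_eq_zero (Finset.univ.erase (0 : K))
      · rw [Finset.card_erase_of_mem (Finset.mem_univ _), Finset.card_univ, hcard]
        rw [degree_lt_iff_coeff_zero] at hr2 ⊢
        intro m hm
        rcases hm.eq_or_lt with h | h
        · rw [← h, h0]
        · exact hr2 m (by omega)
      · intro y hy
        rw [hev, hG1 y (Finset.ne_of_mem_erase hy)]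
    apply hG0
    rw [← hev, hr0, eval_zero]
  have hfin := VV_coeff hr _ hc
  have hl := pw_last D d
  have : (D : ℤ) + 2 ^ d - 1 ≤ N - b * 2 ^ d := by
    have : ((pw D (2 ^ (D + d) - 1) : ℕ) : ℤ) + 1 = D + 2 ^ d := by exact_mod_cast hl
    linarith
  have : D + 2 ^ d * (b + 1) ≤ N + 1 := by
    zify; linarith
  omega

noncomputable def TT {n d : ℕ} (φ : Fin d → Fin n) (p : Fin n → F2) : AffineSubspace F2 (Fin n → F2) :=
  AffineSubspace.mk' p (LinearMap.ker (LinearMap.funLeft F2 F2 φ))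

lemma mem_TT {n d : ℕ} (φ : Fin d → Fin n) (p x : Fin n → F2) :
    x ∈ TT φ p ↔ ∀ j, x (φ j) = p (φ j) := by
  unfold TT
  rw [AffineSubspace.mem_mk', LinearMap.mem_ker, funext_iff]
  simp [LinearMap.funLeft_apply, sub_eq_zero]

lemma TT_ok {n d : ℕ} (φ : Fin d → Fin n) (hφ : Function.Injective φ) (p : Fin n → F2) :
    (TT φ p : Set (Fin n → F2)).Nonempty ∧ Module.finrank F2 (TT φ p).direction = n - d := by
  constructor
  · exact ⟨p, (mem_TT φ p p).2 fun _ => rfl⟩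
  · unfold TT
    rw [AffineSubspace.direction_mk']
    have := LinearMap.finrank_range_add_finrank_ker (LinearMap.funLeft F2 F2 φ)
    rw [LinearMap.range_eq_top.2 (LinearMap.funLeft_surjective_of_injective F2 F2 φ hφ)] at this
    simp at this
    omega

lemma upper (n k d : ℕ) (hk : 1 ≤ k) (hd : 1 ≤ d) (hdn : d ≤ n) :
    ∃ H, IsCoverExact n k d (k - 1) H ∧ Multiset.card H = n + 2 ^ d * k - d - 1 := by
  obtain ⟨b, rfl⟩ : ∃ b, k = b + 1 := ⟨k - 1, by omega⟩
  obtain ⟨D, rfl⟩ : ∃ D, n = d + D := ⟨n - d, by omega⟩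
  let φ : Fin d → Fin (d + D) := Fin.castAdd D
  have hφ : Function.Injective φ := Fin.castAdd_injective _ _
  let ext : (Fin d → F2) → (Fin (d + D) → F2) := fun y => Fin.append y 0
  let ψ : Fin D → Fin d → Fin (d + D) := fun i j =>
    if (j : ℕ) = 0 then Fin.natAdd d i else Fin.castAdd D j
  have hψ : ∀ i, Function.Injective (ψ i) := by
    intro i j j' h
    simp only [ψ] at h
    ext
    split_ifs at h <;> simp [Fin.ext_iff] at h <;> omega
  let A : Multiset (AffineSubspace F2 (Fin (d + D) → F2)) :=
    (Finset.univ : Finset (Fin d → F2)).val.map (fun y => TT φ (ext y))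
  let B : Multiset (AffineSubspace F2 (Fin (d + D) → F2)) :=
    ((Finset.univ : Finset (Fin d → F2)).erase 0).val.map (fun y => TT φ (ext y))
  let E : Multiset (AffineSubspace F2 (Fin (d + D) → F2)) :=
    (Finset.univ : Finset (Fin D)).val.map (fun i => TT (ψ i) (Pi.single (Fin.natAdd d i) 1))
  have hmem : ∀ x y, x ∈ TT φ (ext y) ↔ y = fun j => x (φ j) := by
    intro x y
    rw [mem_TT, funext_iff]
    simp only [ext, φ, Fin.append_left]
    exact forall_congr' fun j => eq_comm
  have hA : ∀ x, covCount (d + D) A x = 1 := by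
    intro x
    unfold covCount
    rw [Multiset.countP_map]
    simp only [hmem]
    change (Finset.univ.filter _).card = 1
    rw [Finset.filter_eq']; simp
  have hsplit : ∀ x, covCount (d + D) (b • A + B + E) x
      = b + covCount (d + D) B x + covCount (d + D) E x := by
    intro x
    have := hA x
    unfold covCount at this ⊢
    rw [Multiset.countP_add, Multiset.countP_add, Multiset.countP_nsmul, this]; simp
  have hB0 : covCount (d + D) B 0 = 0 := by
    unfold covCount
    rw [Multiset.countP_eq_zero]
    intro S hS h
    obtain ⟨y, hy, rfl⟩ := Multiset.mem_map.1 hS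
    rw [hmem] at h
    exact Finset.ne_of_mem_erase hy h
  have hE0 : covCount (d + D) E 0 = 0 := by
    unfold covCount
    rw [Multiset.countP_eq_zero]
    intro S hS h
    obtain ⟨i, hi, rfl⟩ := Multiset.mem_map.1 hS
    rw [mem_TT] at h
    have := h ⟨0, by omega⟩
    simp [ψ] at this
  refine ⟨b • A + B + E, ⟨?_, ?_, ?_⟩, ?_⟩
  · intro S hS
    rcases Multiset.mem_add.1 hS with hS | hS
    · rcases Multiset.mem_add.1 hS with hS | hS
      · obtain ⟨y, hy, rfl⟩ := Multiset.mem_map.1 (Multiset.mem_of_mem_nsmul hS)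
        exact TT_ok φ hφ _
      · obtain ⟨y, hy, rfl⟩ := Multiset.mem_map.1 hS
        exact TT_ok φ hφ _
    · obtain ⟨i, hi, rfl⟩ := Multiset.mem_map.1 hS
      exact TT_ok (ψ i) (hψ i) _
  · intro x hx
    rw [hsplit]
    by_cases h0 : (fun j => x (φ j)) = 0
    · have : 0 < covCount (d + D) E x := by
        unfold covCount
        rw [Multiset.countP_pos]
        have h0' : ∀ j, x (Fin.castAdd D j) = 0 := fun j => congrFun h0 j
        have : ∃ i : Fin D, x (Fin.natAdd d i) ≠ 0 := by
          by_contra hcon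
          push Not at hcon
          apply hx
          funext j
          induction j using Fin.addCases with
          | left j => exact h0' j
          | right j => exact hcon j
        obtain ⟨i, hi⟩ := this
        have h01 : ∀ c : F2, c ≠ 0 → c = 1 := by decide
        refine ⟨_, Multiset.mem_map.2 ⟨i, Finset.mem_univ i, rfl⟩, ?_⟩
        rw [mem_TT]
        intro j
        by_cases hj : (j : ℕ) = 0
        · simp [ψ, hj, h01 _ hi]
        · simp only [ψ, hj, if_false, h0']
          rw [Pi.single_eq_of_ne]
          simp [Fin.ext_iff]; omega
      omega
    · have : 0 < covCount (d + D) B x := by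
        unfold covCount
        rw [Multiset.countP_pos]
        refine ⟨_, Multiset.mem_map.2 ⟨fun j => x (φ j), ?_, rfl⟩, ?_⟩
        · exact Finset.mem_erase.2 ⟨h0, Finset.mem_univ _⟩
        · rw [hmem]
      omega
  · rw [hsplit, hB0, hE0]; simp
  · have c1 : Multiset.card A = 2 ^ d := by
      simp only [A, Multiset.card_map]
      change (Finset.univ : Finset (Fin d → F2)).card = _
      simp
    have c2 : Multiset.card B = 2 ^ d - 1 := by
      simp only [B, Multiset.card_map]
      change (Finset.erase (Finset.univ : Finset (Fin d → F2)) 0).card = _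
      rw [Finset.card_erase_of_mem (Finset.mem_univ _)]
      simp
    have c3 : Multiset.card E = D := by
      simp [E]
    rw [Multiset.card_add, Multiset.card_add, Multiset.card_nsmul, c1, c2, c3]
    have := Nat.one_le_two_pow (n := d)
    have : 2 ^ d * (b + 1) = b * 2 ^ d + 2 ^ d := by ring
    omega

theorem stmt12 (n k d : ℕ) (hn : 1 ≤ n) (hk : 1 ≤ k) (hd : 1 ≤ d) (hdn : d ≤ n) :
    g n k d (k - 1) = n + 2 ^ d * k - d - 1 := by
  unfold g
  have hu := upper n k d hk hd hdn
  apply le_antisymm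
  · exact Nat.sInf_le hu
  · refine le_csInf ⟨_, hu⟩ ?_
    rintro m ⟨H, hH, rfl⟩
    exact lower n k d hn hk hdn H hH
end
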